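/- Let (b_1,…,b_s) be a 1-Wahl chain, set r = K(b_1,…,b_s) and a = K(b_2,…,b_s), and let (e_1,…,e_ℓ) be the Hirzebruch–Jung continued fraction expansion of r/(r−a) (i.e. every e_i ≥ 2, K(e_1,…,e_ℓ) = r and K(e_2,…,e_ℓ) = r − a). Then there exist indices 1 ≤ i < j ≤ ℓ such that the list obtained from (e_1,…,e_ℓ) by decreasing e_i by 1 and e_j by 1 satisfies K = 0. (This is the combinatorial criterion for the existence of an extremal P-resolution of the cyclic quotient singularity of type (1/r)(1,a).) -/

import Mathlib

/-- The (negative/HJ) continuant: `contK [] = 1`, `contK [v] = v`,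
`contK (v₁ :: v₂ :: rest) = v₁ * contK (v₂ :: rest) - contK rest`. -/
def contK : List ℤ → ℤ
  | [] => 1
  | [v] => v
  | v :: w :: rest => v * contK (w :: rest) - contK rest

/-- `k`-Wahl chains: the smallest set of lists of integers containing `[k+2]`
and closed under `[b₁,…,bℓ] ↦ [b₁+1,b₂,…,bℓ,2]` and `[b₁,…,bℓ] ↦ [2,b₁,…,b_{ℓ-1},bℓ+1]`. -/
inductive IsKWahl (k : ℕ) : List ℤ → Prop
  | base : IsKWahl k [(k : ℤ) + 2]
  | right {b : ℤ} {t : List ℤ} : IsKWahl k (b :: t) → IsKWahl k ((b + 1) :: (t ++ [2]))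
  | left {t : List ℤ} {b : ℤ} : IsKWahl k (t ++ [b]) → IsKWahl k (2 :: (t ++ [b + 1]))

/-- Dual `k`-Wahl chains: the smallest set of lists of integers containing the list
of `k+1` twos and closed under the same two operations. -/
inductive IsDualKWahl (k : ℕ) : List ℤ → Prop
  | base : IsDualKWahl k (List.replicate (k + 1) 2)
  | right {b : ℤ} {t : List ℤ} : IsDualKWahl k (b :: t) → IsDualKWahl k ((b + 1) :: (t ++ [2]))
  | left {t : List ℤ} {b : ℤ} : IsDualKWahl k (t ++ [b]) → IsDualKWahl k (2 :: (t ++ [b + 1]))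

/-- The remainder sequence: `rem l i = K(b_{i+1},…,b_s)` for `i ≤ s = l.length`
(so `rem l 0 = r`, `rem l 1 = a`, `rem l s = 1`), and `0` afterwards
(so `rem l (s+1) = 0`). -/
def rem (l : List ℤ) (i : ℕ) : ℤ := if i ≤ l.length then contK (l.drop i) else 0

/-- Run-length encoding of a finite sequence: the lengths of its maximal blocks of
consecutive equal entries. -/
def rle : List ℤ → List ℕ
  | [] => []
  | [_] => [1]
  | a :: b :: t =>
    if a = b then
      match rle (b :: t) with
      | c :: cs => (c + 1) :: cs
      | [] => [1]
    else 1 :: rle (b :: t)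

/-- The length encoding of special representations: the run-length encoding of the
difference sequence `(d₁,…,d_{s-1})` where `dᵢ = aᵢ - a_{i+1}`. -/
def LESR (l : List ℤ) : List ℕ :=
  rle ((List.range (l.length - 1)).map fun i => rem l (i + 1) - rem l (i + 2))

/-- Add `c` to the first entry of a list. -/
def addHead (c : ℤ) : List ℤ → List ℤ
  | [] => []
  | a :: t => (a + c) :: t

/-- Add `c` to the last entry of a list. -/
def addLast (c : ℤ) : List ℤ → List ℤ
  | [] => []
  | [a] => [a + c]
  | a :: b :: t => a :: addLast c (b :: t)

/-- `(c₁,…,c_m)` is a length encoding of the `k`-Wahl chain `W`. -/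
inductive IsLenEnc (k : ℕ) : List ℕ → List ℤ → Prop
  | base : IsLenEnc k [] [(k : ℤ) + 2]
  | left {cs : List ℕ} {l : List ℤ} {c : ℕ} (hc : 0 < c)
      (h : IsLenEnc k cs l) (hhead : l.head? ≠ some 2) :
      IsLenEnc k (cs ++ [c]) (List.replicate c 2 ++ addLast (c : ℤ) l)
  | right {cs : List ℕ} {l : List ℤ} {c : ℕ} (hc : 0 < c)
      (h : IsLenEnc k cs l) (hlast : l.getLast? ≠ some 2) :
      IsLenEnc k (cs ++ [c]) (addHead (c : ℤ) l ++ List.replicate c 2)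

/-- `kcf` is an admissible zero continued fraction for `b`: it has the same length,
`1 ≤ kᵢ ≤ bᵢ` entrywise, and its continuant vanishes. -/
def IsAdmZCF (b kcf : List ℤ) : Prop :=
  List.Forall₂ (fun bi ki => 1 ≤ ki ∧ ki ≤ bi) b kcf ∧ contK kcf = 0

/-- The matrix `∏ [[vᵢ, -1], [1, 0]]`, whose first column consists of the continuants of
`l` and of `l.tail`. -/
def contMat (l : List ℤ) : Matrix (Fin 2) (Fin 2) ℤ :=
  (l.map fun v => !![v, -1; 1, 0]).prod

/-- Decrease the entries at the positions `i` and `j` by `1`. -/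
def decAt (i j : ℕ) (e : List ℤ) : List ℤ :=
  e.mapIdx fun idx x => if idx = i ∨ idx = j then x - 1 else x

theorem contMat_nil : contMat [] = 1 := rfl

theorem contMat_cons (v : ℤ) (t : List ℤ) :
    contMat (v :: t) = !![v, -1; 1, 0] * contMat t := by
  simp [contMat]

theorem contMat_append (s t : List ℤ) : contMat (s ++ t) = contMat s * contMat t := by
  simp [contMat]

theorem contMat_singleton (v : ℤ) : contMat [v] = !![v, -1; 1, 0] := by
  simp [contMat]

theorem contMat_cons_zero (v : ℤ) (t : List ℤ) :
    contMat (v :: t) 0 0 = v * contMat t 0 0 - contMat t 1 0 := by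
  simp [contMat_cons, Matrix.mul_apply, Fin.sum_univ_two, sub_eq_add_neg]

theorem contMat_cons_one (v : ℤ) (t : List ℤ) :
    contMat (v :: t) 1 0 = contMat t 0 0 := by
  simp [contMat_cons, Matrix.mul_apply, Fin.sum_univ_two]

theorem contMat_cons_add_one (v : ℤ) (t : List ℤ) :
    contMat ((v + 1) :: t) = !![1, 1; 0, 1] * contMat (v :: t) := by
  rw [contMat_cons, contMat_cons, ← mul_assoc]
  congr 1
  ext i j; fin_cases i <;> fin_cases j <;> simp

theorem contMat_append_add_one (t : List ℤ) (v : ℤ) :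
    contMat (t ++ [v + 1]) = contMat (t ++ [v]) * !![1, 0; -1, 1] := by
  rw [contMat_append, contMat_append, mul_assoc]
  congr 1
  rw [contMat_singleton, contMat_singleton]
  ext i j; fin_cases i <;> fin_cases j <;> simp

theorem contK_eq_contMat (l : List ℤ) : contK l = contMat l 0 0 := by
  induction l using contK.induct with
  | case1 => simp [contK, contMat]
  | case2 v => simp [contK, contMat]
  | case3 v w t ih₁ ih₂ =>
    rw [contK, ih₁, ih₂, contMat_cons_zero v, contMat_cons_one]

theorem contK_tail_eq_contMat {l : List ℤ} (hl : l ≠ []) :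
    contK l.tail = contMat l 1 0 := by
  obtain ⟨v, t, rfl⟩ := List.exists_cons_of_ne_nil hl
  rw [contMat_cons_one, List.tail_cons, contK_eq_contMat]

theorem contMat_one_zero_lt {e : List ℤ} (he : ∀ x ∈ e, 2 ≤ x) :
    0 ≤ contMat e 1 0 ∧ contMat e 1 0 < contMat e 0 0 := by
  induction e with
  | nil => simp [contMat]
  | cons v t ih =>
    obtain ⟨h₀, h₁⟩ := ih fun x hx => he x (List.mem_cons_of_mem _ hx)
    have hv := he v List.mem_cons_self
    rw [contMat_cons_zero, contMat_cons_one]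
    constructor <;> nlinarith

/-- Uniqueness of Hirzebruch–Jung expansions. -/
theorem eq_of_contMat_eq {e f : List ℤ} (he : ∀ x ∈ e, 2 ≤ x) (hf : ∀ x ∈ f, 2 ≤ x)
    (h₀ : contMat e 0 0 = contMat f 0 0) (h₁ : contMat e 1 0 = contMat f 1 0) : e = f := by
  induction e generalizing f with
  | nil =>
    cases f with
    | nil => rfl
    | cons w s =>
      have := contMat_one_zero_lt fun x hx => hf x (List.mem_cons_of_mem _ hx)
      simp only [contMat_cons_one, contMat_nil, Matrix.one_apply_ne one_ne_zero] at h₁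
      omega
  | cons v t ih =>
    have ht := fun x hx => he x (List.mem_cons_of_mem v hx)
    have bt := contMat_one_zero_lt ht
    cases f with
    | nil =>
      simp only [contMat_cons_one, contMat_nil, Matrix.one_apply_ne one_ne_zero] at h₁
      omega
    | cons w s =>
      have hs := fun x hx => hf x (List.mem_cons_of_mem w hx)
      have bs := contMat_one_zero_lt hs
      rw [contMat_cons_one, contMat_cons_one] at h₁
      rw [contMat_cons_zero, contMat_cons_zero, ← h₁] at h₀
      rw [← h₁] at bs
      have hvw : v = w := by
        rcases lt_trichotomy v w with h | h | h
        · nlinarith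
        · exact h
        · nlinarith
      subst hvw
      rw [ih ht hs h₁ (by linarith)]

theorem decAt_cons_succ (i j : ℕ) (v : ℤ) (t : List ℤ) :
    decAt (i + 1) (j + 1) (v :: t) = v :: decAt i j t := by
  simp [decAt, List.mapIdx_cons]

theorem decAt_append_singleton_of_lt {i j : ℕ} {t : List ℤ} (hi : i < t.length)
    (hj : j < t.length) (v : ℤ) : decAt i j (t ++ [v]) = decAt i j t ++ [v] := by
  simp [decAt, List.mapIdx_append, hi.ne', hj.ne']

theorem contMat_decAt_cons_add_one (i j : ℕ) (v : ℤ) (t : List ℤ) :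
    contMat (decAt i j ((v + 1) :: t)) = !![1, 1; 0, 1] * contMat (decAt i j (v :: t)) := by
  simp only [decAt, List.mapIdx_cons]
  rw [← contMat_cons_add_one]
  split_ifs <;> simp

theorem contMat_decAt_append_add_one (i j : ℕ) (t : List ℤ) (v : ℤ) :
    contMat (decAt i j (t ++ [v + 1])) = contMat (decAt i j (t ++ [v])) * !![1, 0; -1, 1] := by
  simp only [decAt, List.mapIdx_append, List.mapIdx_cons, List.mapIdx_nil]
  rw [← contMat_append_add_one]
  split_ifs <;> simp

/-- Every `1`-Wahl chain has a dual chain which has two entries whose decrease by `1` gives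
a chain with the same matrix as `[1, 1]`. -/
theorem IsKWahl.exists_dual {b : List ℤ} (h : IsKWahl 1 b) :
    ∃ (e : List ℤ) (i j : ℕ), (∀ x ∈ e, 2 ≤ x) ∧ i < j ∧ j < e.length ∧
      contMat e = !![1, 0; 1, -1] * contMat b * !![1, -1; 0, -1] ∧
      contMat (decAt i j e) = !![0, -1; 1, -1] := by
  induction h with
  | base =>
    refine ⟨[2, 2], 0, 1, by simp, by simp, by simp, ?_, ?_⟩
    · simp [contMat]
    · simp [contMat, decAt, List.mapIdx_cons]
  | @right b t _ ih =>
    obtain ⟨e, i, j, he, hij, hj, hM, hD⟩ := ih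
    obtain ⟨s, x, rfl⟩ := (List.eq_nil_or_concat' e).resolve_left (by rintro rfl; simp at hj)
    refine ⟨2 :: (s ++ [x + 1]), i + 1, j + 1, ?_, by omega, by simpa using hj, ?_, ?_⟩
    · have := he x (by simp)
      intro y hy
      simp only [List.mem_cons, List.mem_append, List.not_mem_nil, or_false] at hy
      rcases hy with rfl | hy | rfl
      · rfl
      · exact he y (by simp [hy])
      · omega
    · rw [contMat_cons, contMat_append_add_one, hM, ← List.cons_append, contMat_append,
        contMat_cons_add_one, contMat_singleton]
      have h₁ : !![2, -1; 1, 0] * !![1, 0; 1, -1] =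
          (!![1, 0; 1, -1] * !![1, 1; 0, 1] : Matrix (Fin 2) (Fin 2) ℤ) := by decide
      have h₂ : !![1, -1; 0, -1] * !![1, 0; -1, 1] =
          (!![2, -1; 1, 0] * !![1, -1; 0, -1] : Matrix (Fin 2) (Fin 2) ℤ) := by decide
      simp only [mul_assoc, h₂]
      simp only [← mul_assoc, h₁]
    · rw [decAt_cons_succ, contMat_cons, contMat_decAt_append_add_one, hD]
      decide
  | @left t b _ ih =>
    obtain ⟨e, i, j, he, hij, hj, hM, hD⟩ := ih
    obtain ⟨x, s, rfl⟩ := List.exists_cons_of_ne_nil (l := e) (by rintro rfl; simp at hj)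
    refine ⟨((x + 1) :: s) ++ [2], i, j, ?_, hij, by simp at hj ⊢; omega, ?_, ?_⟩
    · have := he x (by simp)
      intro y hy
      simp only [List.mem_cons, List.mem_append, List.not_mem_nil, or_false] at hy
      rcases hy with (rfl | hy) | rfl
      · omega
      · exact he y (by simp [hy])
      · rfl
    · rw [contMat_append, contMat_cons_add_one, hM, contMat_singleton, contMat_cons,
        contMat_append_add_one]
      have h₁ : !![1, 1; 0, 1] * !![1, 0; 1, -1] =
          (!![1, 0; 1, -1] * !![2, -1; 1, 0] : Matrix (Fin 2) (Fin 2) ℤ) := by decide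
      have h₂ : !![1, -1; 0, -1] * !![2, -1; 1, 0] =
          (!![1, 0; -1, 1] * !![1, -1; 0, -1] : Matrix (Fin 2) (Fin 2) ℤ) := by decide
      simp only [mul_assoc, h₂]
      simp only [← mul_assoc, h₁]
    · rw [decAt_append_singleton_of_lt (by simp at hj ⊢; omega) (by simpa using hj),
        contMat_append, contMat_decAt_cons_add_one, hD, contMat_singleton]
      decide

theorem IsKWahl.ne_nil {k : ℕ} {b : List ℤ} (h : IsKWahl k b) : b ≠ [] := by
  cases h <;> simp

/-- If `(b₁,…,b_s)` is a `1`-Wahl chain with `r = K(b)` and `a = K(b.tail)`, and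
`(e₁,…,e_ℓ)` is the HJ expansion of `r/(r-a)`, then there are indices `i < j` such
that decreasing `eᵢ` and `e_j` each by `1` yields vanishing continuant
(the criterion for an extremal P-resolution). -/
theorem oneWahl_extremal_P_resolution (b : List ℤ) (h : IsKWahl 1 b)
    (e : List ℤ) (he2 : ∀ x ∈ e, 2 ≤ x)
    (hr : contK e = contK b) (ha : contK e.tail = contK b - contK b.tail) :
    ∃ i j : ℕ, i < j ∧ j < e.length ∧
      contK (e.mapIdx fun idx x => if idx = i ∨ idx = j then x - 1 else x) = 0 := by
  obtain ⟨f, i, j, hf2, hij, hj, hM, hD⟩ := h.exists_dual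
  have hM0 : contMat f 0 0 = contK b := by
    rw [hM, contK_eq_contMat]
    simp [Matrix.mul_apply, Matrix.vecMul, dotProduct]
  have hM1 : contMat f 1 0 = contK b - contK b.tail := by
    rw [hM, contK_eq_contMat b, contK_tail_eq_contMat h.ne_nil]
    simp [Matrix.mul_apply, Matrix.vecMul, dotProduct, sub_eq_add_neg]
  have he : e ≠ [] := by
    rintro rfl
    have := contMat_one_zero_lt hf2
    simp only [List.tail_nil] at ha
    omega
  have hef : e = f := by
    refine eq_of_contMat_eq he2 hf2 ?_ ?_
    · rw [hM0, ← hr, contK_eq_contMat]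
    · rw [hM1, ← ha, contK_tail_eq_contMat he]
  subst hef
  refine ⟨i, j, hij, hj, ?_⟩
  change contK (decAt i j e) = 0
  rw [contK_eq_contMat, hD]
  rfl
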